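/- With the q-quadratic lattice and the operators D_x, S_x as in the context, let φ(z) = az² + bz + c and ψ(z) = dz + e be complex polynomials, and define recursively φ^{[0]} = φ, ψ^{[0]} = ψ, φ^{[k+1]} = S_xφ^{[k]} + U₁·S_xψ^{[k]} + α·U₂·D_xψ^{[k]}, ψ^{[k+1]} = D_xφ^{[k]} + α·S_xψ^{[k]} + U₁·D_xψ^{[k]}. Then for every k ≥ 0: ψ^{[k]}(z) = (aγ_{2k} + dα_{2k})(z−𝔠₃) + φ′(𝔠₃)γ_k + ψ(𝔠₃)α_k, and φ^{[k]}(z) = (d(α²−1)γ_{2k} + aα_{2k})((z−𝔠₃)² − 2𝔠₁𝔠₂) + (φ′(𝔠₃)α_k + ψ(𝔠₃)(α²−1)γ_k)(z−𝔠₃) + φ(𝔠₃) + 2a𝔠₁𝔠₂. -/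

import Mathlib

open Polynomial

noncomputable def qp (q : ℝ) (t : ℂ) : ℂ := Complex.exp (t * (Real.log q : ℂ))

noncomputable def alphaL (q : ℝ) : ℂ := (qp q (1/2) + qp q (-(1/2))) / 2

noncomputable def alphaN (q : ℝ) (n : ℕ) : ℂ :=
  (qp q ((n : ℂ) / 2) + qp q (-((n : ℂ) / 2))) / 2

noncomputable def gammaN (q : ℝ) (n : ℕ) : ℂ :=
  (qp q ((n : ℂ) / 2) - qp q (-((n : ℂ) / 2))) / (qp q (1/2) - qp q (-(1/2)))

noncomputable def latX (q : ℝ) (c1 c2 c3 s : ℂ) : ℂ := c1 * qp q (-s) + c2 * qp q s + c3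

noncomputable def U1L (q : ℝ) (c3 : ℂ) : Polynomial ℂ :=
  Polynomial.C (alphaL q ^ 2 - 1) * (Polynomial.X - Polynomial.C c3)

noncomputable def U2L (q : ℝ) (c1 c2 c3 : ℂ) : Polynomial ℂ :=
  Polynomial.C (alphaL q ^ 2 - 1) *
    ((Polynomial.X - Polynomial.C c3) ^ 2 - Polynomial.C (4 * c1 * c2))

theorem qp_add (q : ℝ) (s t : ℂ) : qp q (s + t) = qp q s * qp q t := by
  simp only [qp, add_mul, Complex.exp_add]

theorem qp_neg (q : ℝ) (s : ℂ) : qp q (-s) = (qp q s)⁻¹ := by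
  simp only [qp, neg_mul, Complex.exp_neg]

theorem qp_ne_zero (q : ℝ) (s : ℂ) : qp q s ≠ 0 := Complex.exp_ne_zero _

theorem exists_qp_eq {q : ℝ} (hq : 0 < q) (hq1 : q ≠ 1) {u : ℂ} (hu : u ≠ 0) :
    ∃ s, qp q s = u := by
  have hl : (Real.log q : ℂ) ≠ 0 :=
    Complex.ofReal_ne_zero.mpr (Real.log_ne_zero_of_pos_of_ne_one hq hq1)
  refine ⟨Complex.log u / Real.log q, ?_⟩
  rw [qp, div_mul_cancel₀ _ hl, Complex.exp_log hu]

theorem qp_half_sq_ne_one {q : ℝ} (hq : 0 < q) (hq1 : q ≠ 1) : qp q (1 / 2) ^ 2 ≠ 1 := by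
  have h : qp q (1 / 2) ^ 2 = q := by
    rw [sq, ← qp_add, qp, add_halves, one_mul, ← Complex.ofReal_exp, Real.exp_log hq]
  rw [h]
  exact_mod_cast hq1

theorem qp_half_sub_inv_ne_zero {q : ℝ} (hq : 0 < q) (hq1 : q ≠ 1) :
    qp q (1 / 2) - (qp q (1 / 2))⁻¹ ≠ 0 := by
  intro h
  apply qp_half_sq_ne_one hq hq1
  have hr := qp_ne_zero q (1 / 2)
  field_simp at h
  linear_combination h

theorem latX_add_half (q : ℝ) (c1 c2 c3 s : ℂ) :
    latX q c1 c2 c3 (s + 1 / 2) =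
      c1 * ((qp q s)⁻¹ * (qp q (1 / 2))⁻¹) + c2 * (qp q s * qp q (1 / 2)) + c3 := by
  rw [latX, qp_neg, qp_add, mul_inv]

theorem latX_sub_half (q : ℝ) (c1 c2 c3 s : ℂ) :
    latX q c1 c2 c3 (s - 1 / 2) =
      c1 * ((qp q s)⁻¹ * qp q (1 / 2)) + c2 * (qp q s * (qp q (1 / 2))⁻¹) + c3 := by
  rw [latX, qp_neg, sub_eq_add_neg, qp_add, qp_neg, mul_inv, inv_inv]

theorem latX_surjective {q : ℝ} (hq : 0 < q) (hq1 : q ≠ 1) {c1 c2 : ℂ} (hc : c1 * c2 ≠ 0)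
    (c3 : ℂ) : Function.Surjective (latX q c1 c2 c3) := by
  intro z
  have hc1 := left_ne_zero_of_mul hc
  have hc2 := right_ne_zero_of_mul hc
  obtain ⟨w, hw⟩ := IsAlgClosed.exists_pow_nat_eq ((z - c3) ^ 2 - 4 * c1 * c2) two_pos
  have hroot : c2 * ((z - c3 + w) / (2 * c2)) ^ 2 - (z - c3) * ((z - c3 + w) / (2 * c2)) + c1
      = 0 := by
    field_simp
    linear_combination hw
  generalize (z - c3 + w) / (2 * c2) = u at hroot
  have hu : u ≠ 0 := by
    rintro rfl
    exact hc1 (by simpa using hroot)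
  obtain ⟨s, rfl⟩ := exists_qp_eq hq hq1 hu
  refine ⟨s, ?_⟩
  rw [latX, qp_neg]
  field_simp
  linear_combination hroot

/-- The two neighbours of a lattice point coincide only at the zeros of `(z - c3)² - 4 c1 c2`. -/
theorem latX_add_half_ne_sub_half {q : ℝ} (hq : 0 < q) (hq1 : q ≠ 1) {c1 c2 c3 s : ℂ}
    (h : (latX q c1 c2 c3 s - c3) ^ 2 - 4 * c1 * c2 ≠ 0) :
    latX q c1 c2 c3 (s + 1 / 2) ≠ latX q c1 c2 c3 (s - 1 / 2) := by
  intro he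
  apply h
  have hu := qp_ne_zero q s
  rw [latX_add_half, latX_sub_half] at he
  have hp : (c2 * qp q s - c1 * (qp q s)⁻¹) * (qp q (1 / 2) - (qp q (1 / 2))⁻¹) = 0 := by
    linear_combination he
  have h0 := (mul_eq_zero.mp hp).resolve_right (qp_half_sub_inv_ne_zero hq hq1)
  rw [latX, qp_neg]
  have hi := mul_inv_cancel₀ hu
  linear_combination (c2 * qp q s - c1 * (qp q s)⁻¹) * h0 + 4 * c1 * c2 * hi

theorem eq_of_forall_eval_latX {q : ℝ} (hq : 0 < q) (hq1 : q ≠ 1) {c1 c2 c3 : ℂ}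
    (hc : c1 * c2 ≠ 0) {f g : ℂ[X]}
    (h : ∀ s, latX q c1 c2 c3 (s + 1 / 2) ≠ latX q c1 c2 c3 (s - 1 / 2) →
      f.eval (latX q c1 c2 c3 s) = g.eval (latX q c1 c2 c3 s)) : f = g := by
  have hW : (X - C c3) ^ 2 - C (4 * c1 * c2) ≠ 0 := by
    intro h0
    have := congrArg (eval c3) h0
    simp at this
    exact hc (by simpa using this)
  apply mul_right_cancel₀ hW
  refine Polynomial.funext fun z => ?_
  obtain ⟨s, rfl⟩ := latX_surjective hq hq1 hc c3 z
  by_cases h0 : (latX q c1 c2 c3 s - c3) ^ 2 - 4 * c1 * c2 = 0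
  · simp only [eval_mul, eval_sub, eval_pow, eval_X, eval_C, h0, mul_zero]
  · rw [eval_mul, eval_mul, h s (latX_add_half_ne_sub_half hq hq1 h0)]

theorem alphaL_eq (q : ℝ) : alphaL q = (qp q (1 / 2) + (qp q (1 / 2))⁻¹) / 2 := by
  rw [alphaL, qp_neg]

theorem qp_natCast_div_two (q : ℝ) (n : ℕ) : qp q ((n : ℂ) / 2) = qp q (1 / 2) ^ n := by
  rw [qp, qp, ← Complex.exp_nat_mul]
  congr 1
  ring

theorem alphaN_eq (q : ℝ) (n : ℕ) :
    alphaN q n = (qp q (1 / 2) ^ n + (qp q (1 / 2))⁻¹ ^ n) / 2 := by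
  rw [alphaN, qp_neg, qp_natCast_div_two, inv_pow]

theorem gammaN_eq (q : ℝ) (n : ℕ) :
    gammaN q n = (qp q (1 / 2) ^ n - (qp q (1 / 2))⁻¹ ^ n) /
      (qp q (1 / 2) - (qp q (1 / 2))⁻¹) := by
  rw [gammaN, qp_neg, qp_neg, qp_natCast_div_two, inv_pow]

theorem alphaN_zero (q : ℝ) : alphaN q 0 = 1 := by
  rw [alphaN_eq]
  norm_num

theorem gammaN_zero (q : ℝ) : gammaN q 0 = 0 := by
  simp [gammaN_eq]

theorem gammaN_succ {q : ℝ} (hq : 0 < q) (hq1 : q ≠ 1) (n : ℕ) :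
    gammaN q (n + 1) = alphaL q * gammaN q n + alphaN q n := by
  have hd := qp_half_sub_inv_ne_zero hq hq1
  rw [gammaN_eq, gammaN_eq, alphaN_eq, alphaL_eq]
  generalize (qp q (1 / 2))⁻¹ = t at *
  field_simp
  ring

theorem alphaN_succ {q : ℝ} (hq : 0 < q) (hq1 : q ≠ 1) (n : ℕ) :
    alphaN q (n + 1) = alphaL q * alphaN q n + (alphaL q ^ 2 - 1) * gammaN q n := by
  have hd := qp_half_sub_inv_ne_zero hq hq1
  have hi := mul_inv_cancel₀ (qp_ne_zero q (1 / 2))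
  have hk : alphaL q ^ 2 - 1 = ((qp q (1 / 2) - (qp q (1 / 2))⁻¹) / 2) ^ 2 := by
    rw [alphaL_eq]
    linear_combination hi
  rw [hk, gammaN_eq, alphaN_eq, alphaN_eq, alphaL_eq]
  generalize (qp q (1 / 2))⁻¹ = t at *
  field_simp
  ring

theorem averaging_quadratic {q : ℝ} (hq : 0 < q) (hq1 : q ≠ 1) {c1 c2 c3 : ℂ}
    (hc : c1 * c2 ≠ 0) {Sx : ℂ[X] → ℂ[X]}
    (hSx : ∀ (f : ℂ[X]) (s : ℂ),
      (Sx f).eval (latX q c1 c2 c3 s) =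
        (f.eval (latX q c1 c2 c3 (s + 1/2)) + f.eval (latX q c1 c2 c3 (s - 1/2))) / 2)
    (A B K : ℂ) :
    Sx (C A * ((X - C c3) ^ 2 - C (2 * c1 * c2)) + C B * (X - C c3) + C K) =
      C (A * (2 * alphaL q ^ 2 - 1)) * ((X - C c3) ^ 2 - C (2 * c1 * c2)) +
        C (B * alphaL q) * (X - C c3) + C K := by
  refine eq_of_forall_eval_latX (c3 := c3) hq hq1 hc fun s _ => ?_
  have hr := qp_ne_zero q (1 / 2)
  have hu := qp_ne_zero q s
  rw [hSx, latX_add_half, latX_sub_half, latX, qp_neg, alphaL_eq]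
  simp only [eval_add, eval_mul, eval_sub, eval_pow, eval_X, eval_C]
  field_simp
  ring

theorem averaging_linear {q : ℝ} (hq : 0 < q) (hq1 : q ≠ 1) {c1 c2 c3 : ℂ}
    (hc : c1 * c2 ≠ 0) {Sx : ℂ[X] → ℂ[X]}
    (hSx : ∀ (f : ℂ[X]) (s : ℂ),
      (Sx f).eval (latX q c1 c2 c3 s) =
        (f.eval (latX q c1 c2 c3 (s + 1/2)) + f.eval (latX q c1 c2 c3 (s - 1/2))) / 2)
    (B K : ℂ) :
    Sx (C B * (X - C c3) + C K) = C (B * alphaL q) * (X - C c3) + C K := by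
  simpa using averaging_quadratic hq hq1 hc hSx 0 B K

theorem divided_difference_quadratic {q : ℝ} (hq : 0 < q) (hq1 : q ≠ 1) {c1 c2 c3 : ℂ}
    (hc : c1 * c2 ≠ 0) {Dx : ℂ[X] → ℂ[X]}
    (hDx : ∀ (f : ℂ[X]) (s : ℂ),
      latX q c1 c2 c3 (s + 1/2) ≠ latX q c1 c2 c3 (s - 1/2) →
      (Dx f).eval (latX q c1 c2 c3 s) =
        (f.eval (latX q c1 c2 c3 (s + 1/2)) - f.eval (latX q c1 c2 c3 (s - 1/2))) /
          (latX q c1 c2 c3 (s + 1/2) - latX q c1 c2 c3 (s - 1/2)))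
    (A B K : ℂ) :
    Dx (C A * ((X - C c3) ^ 2 - C (2 * c1 * c2)) + C B * (X - C c3) + C K) =
      C (2 * A * alphaL q) * (X - C c3) + C B := by
  refine eq_of_forall_eval_latX (c3 := c3) hq hq1 hc fun s hs => ?_
  have hsum : latX q c1 c2 c3 (s + 1 / 2) + latX q c1 c2 c3 (s - 1 / 2) - 2 * c3 =
      2 * alphaL q * (latX q c1 c2 c3 s - c3) := by
    rw [latX_add_half, latX_sub_half, latX, qp_neg, alphaL_eq]
    ring
  rw [hDx _ _ hs, div_eq_iff (sub_ne_zero.mpr hs)]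
  simp only [eval_add, eval_mul, eval_sub, eval_pow, eval_X, eval_C]
  linear_combination
    A * (latX q c1 c2 c3 (s + 1 / 2) - latX q c1 c2 c3 (s - 1 / 2)) * hsum

theorem divided_difference_linear {q : ℝ} (hq : 0 < q) (hq1 : q ≠ 1) {c1 c2 c3 : ℂ}
    (hc : c1 * c2 ≠ 0) {Dx : ℂ[X] → ℂ[X]}
    (hDx : ∀ (f : ℂ[X]) (s : ℂ),
      latX q c1 c2 c3 (s + 1/2) ≠ latX q c1 c2 c3 (s - 1/2) →
      (Dx f).eval (latX q c1 c2 c3 s) =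
        (f.eval (latX q c1 c2 c3 (s + 1/2)) - f.eval (latX q c1 c2 c3 (s - 1/2))) /
          (latX q c1 c2 c3 (s + 1/2) - latX q c1 c2 c3 (s - 1/2)))
    (B K : ℂ) :
    Dx (C B * (X - C c3) + C K) = C B := by
  simpa using divided_difference_quadratic hq hq1 hc hDx 0 B K

theorem stmt_7 (q : ℝ) (hq : 0 < q) (hq1 : q ≠ 1) (c1 c2 c3 : ℂ) (hc : c1 * c2 ≠ 0)
    (Dx Sx : Polynomial ℂ → Polynomial ℂ)
    (hDx : ∀ (f : Polynomial ℂ) (s : ℂ),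
      latX q c1 c2 c3 (s + 1/2) ≠ latX q c1 c2 c3 (s - 1/2) →
      (Dx f).eval (latX q c1 c2 c3 s) =
        (f.eval (latX q c1 c2 c3 (s + 1/2)) - f.eval (latX q c1 c2 c3 (s - 1/2))) /
          (latX q c1 c2 c3 (s + 1/2) - latX q c1 c2 c3 (s - 1/2)))
    (hSx : ∀ (f : Polynomial ℂ) (s : ℂ),
      (Sx f).eval (latX q c1 c2 c3 s) =
        (f.eval (latX q c1 c2 c3 (s + 1/2)) + f.eval (latX q c1 c2 c3 (s - 1/2))) / 2)
    (pa pb pc pd pe : ℂ)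
    (Phi Psi : ℕ → Polynomial ℂ)
    (hPhi0 : Phi 0 = C pa * X ^ 2 + C pb * X + C pc)
    (hPsi0 : Psi 0 = C pd * X + C pe)
    (hPhiRec : ∀ k, Phi (k + 1) =
      Sx (Phi k) + U1L q c3 * Sx (Psi k) + C (alphaL q) * U2L q c1 c2 c3 * Dx (Psi k))
    (hPsiRec : ∀ k, Psi (k + 1) =
      Dx (Phi k) + C (alphaL q) * Sx (Psi k) + U1L q c3 * Dx (Psi k)) :
    ∀ k : ℕ,
      Psi k = C (pa * gammaN q (2 * k) + pd * alphaN q (2 * k)) * (X - C c3) +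
        C ((2 * pa * c3 + pb) * gammaN q k + (pd * c3 + pe) * alphaN q k) ∧
      Phi k = C (pd * (alphaL q ^ 2 - 1) * gammaN q (2 * k) + pa * alphaN q (2 * k)) *
          ((X - C c3) ^ 2 - C (2 * c1 * c2)) +
        C ((2 * pa * c3 + pb) * alphaN q k + (pd * c3 + pe) * (alphaL q ^ 2 - 1) * gammaN q k) *
          (X - C c3) +
        C (pa * c3 ^ 2 + pb * c3 + pc + 2 * pa * c1 * c2) := by
  intro k
  induction k with
  | zero =>
    rw [hPhi0, hPsi0, mul_zero, alphaN_zero, gammaN_zero]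
    constructor
    all_goals
      simp only [C_add, C_mul, C_pow, C_0, C_ofNat, mul_zero, mul_one]
      ring
  | succ k ih =>
    obtain ⟨hPsi, hPhi⟩ := ih
    rw [hPhiRec, hPsiRec, hPsi, hPhi, averaging_quadratic hq hq1 hc hSx,
      averaging_linear hq hq1 hc hSx, divided_difference_quadratic hq hq1 hc hDx,
      divided_difference_linear hq hq1 hc hDx, show 2 * (k + 1) = 2 * k + 1 + 1 by ring]
    simp only [gammaN_succ hq hq1, alphaN_succ hq hq1, U1L, U2L]
    constructor
    all_goals
      simp only [C_add, C_mul, C_pow, C_sub, C_1, C_ofNat]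
      ring
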